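/- Let M be an R-module projective in σ[M], semiprime, satisfying ACC on annihilators, with minimal primes in M being P_1, ..., P_n (n ≥ 2). Then Ann_M^r(P_i) = ∩_{j ≠ i} P_j for each i. -/

import Mathlib

/- Common definitions: the category σ[M], projectivity in σ[M], the product
   K_M L of submodules, annihilators, prime/semiprime submodules, hereditary
   torsion theories, M-singular modules, etc., following the paper. -/

universe u v

section Defs

variable (R : Type u) [Ring R]

/-- `N` belongs to `σ[M]`: `N` is isomorphic to a submodule of an `M`-generated
module, i.e. `N` embeds into a quotient of a direct sum of copies of `M`. -/
def InSigma (M : Type v) [AddCommGroup M] [Module R M]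
    (N : Type v) [AddCommGroup N] [Module R N] : Prop :=
  ∃ (ι : Type v) (K : Submodule R (ι →₀ M)) (g : N →ₗ[R] ((ι →₀ M) ⧸ K)),
    Function.Injective g

/-- `M` is projective in `σ[M]`. -/
def ProjInSigma (M : Type v) [AddCommGroup M] [Module R M] : Prop :=
  ∀ (A B : Type v) [AddCommGroup A] [Module R A] [AddCommGroup B] [Module R B],
    InSigma R M A → InSigma R M B →
      ∀ (p : A →ₗ[R] B), Function.Surjective p →
        ∀ f : M →ₗ[R] B, ∃ g : M →ₗ[R] A, p.comp g = f

variable (M : Type v) [AddCommGroup M] [Module R M]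

/-- The product `K_M L = Σ { f(K) : f ∈ Hom_R(M, L) }` of submodules of `M`. -/
def prodM (K L : Submodule R M) : Submodule R M :=
  ⨆ f ∈ {f : M →ₗ[R] M | LinearMap.range f ≤ L}, Submodule.map f K

/-- `Ann_M(X) = ∩ { ker f : f ∈ Hom_R(M, X) }`. -/
def annM (X : Type v) [AddCommGroup X] [Module R X] : Submodule R M :=
  ⨅ f : M →ₗ[R] X, LinearMap.ker f

/-- The right annihilator `Ann_M^r(N) = Σ { L ⊆ M : N_M L = 0 }`. -/
def annMr (N : Submodule R M) : Submodule R M :=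
  sSup {L : Submodule R M | prodM R M N L = ⊥}

/-- A submodule is fully invariant if it is stable under all endomorphisms. -/
def IsFullyInvariant (N : Submodule R M) : Prop :=
  ∀ f : M →ₗ[R] M, Submodule.map f N ≤ N

/-- `M` is a semiprime module: `K_M K = 0` implies `K = 0`. -/
def IsSemiprime : Prop :=
  ∀ K : Submodule R M, prodM R M K K = ⊥ → K = ⊥

/-- `P` is prime in `M`. -/
def PrimeIn (P : Submodule R M) : Prop :=
  P ≠ ⊤ ∧ IsFullyInvariant R M P ∧
    ∀ K L : Submodule R M, IsFullyInvariant R M K → IsFullyInvariant R M L →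
      prodM R M K L ≤ P → K ≤ P ∨ L ≤ P

/-- `P` is a minimal prime in `M`. -/
def MinPrimeIn (P : Submodule R M) : Prop :=
  PrimeIn R M P ∧ ∀ Q : Submodule R M, PrimeIn R M Q → Q ≤ P → Q = P

/-- Powers of a submodule: `powM N k = N^(k+1)`, i.e. `powM N 0 = N` and
`powM N (k+1) = N_M (powM N k)`. -/
def powM (N : Submodule R M) : ℕ → Submodule R M
  | 0 => N
  | k + 1 => prodM R M N (powM N k)

/-- The set of annihilator submodules `∩_{f ∈ X} ker f` for `X ⊆ End_R(M)`. -/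
def AnnSet : Set (Submodule R M) :=
  {N | ∃ X : Set (M →ₗ[R] M), N = ⨅ f ∈ X, LinearMap.ker f}

/-- `M` satisfies ACC on annihilators. -/
def AccOnAnnihilators : Prop :=
  ∀ c : ℕ → Submodule R M, (∀ n, c n ∈ AnnSet R M) → Monotone c →
    ∃ n, ∀ m, n ≤ m → c m = c n

/-- `U` is a uniform submodule of `M`. -/
def UniformSub (U : Submodule R M) : Prop :=
  U ≠ ⊥ ∧ ∀ A B : Submodule R M, A ≤ U → B ≤ U → A ≠ ⊥ → B ≠ ⊥ → A ⊓ B ≠ ⊥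

end Defs

section Torsion

variable (R : Type u) [Ring R]

/-- A hereditary torsion theory, presented via its torsion class: a class of
modules closed under submodules, quotients, extensions, isomorphisms and
direct sums. -/
structure HTC : Type (max u (v + 1)) where
  torsion : ∀ (N : Type v) [AddCommGroup N] [Module R N], Prop
  closed_sub : ∀ (N : Type v) [AddCommGroup N] [Module R N],
    torsion N → ∀ K : Submodule R N, torsion K
  closed_quot : ∀ (N : Type v) [AddCommGroup N] [Module R N],
    torsion N → ∀ K : Submodule R N, torsion (N ⧸ K)
  closed_ext : ∀ (N : Type v) [AddCommGroup N] [Module R N] (K : Submodule R N),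
    torsion K → torsion (N ⧸ K) → torsion N
  closed_iso : ∀ (N N' : Type v) [AddCommGroup N] [Module R N]
    [AddCommGroup N'] [Module R N'], (N ≃ₗ[R] N') → torsion N → torsion N'
  closed_dsum : ∀ (ι : Type v) (F : ι → Type v) [DecidableEq ι]
    [∀ i, AddCommGroup (F i)] [∀ i, Module R (F i)],
    (∀ i, torsion (F i)) → torsion (DirectSum ι F)

/-- `N` is `τ`-torsion-free. -/
def TorsionFreeFor (τ : HTC.{u, v} R) (N : Type v) [AddCommGroup N] [Module R N] : Prop :=
  ∀ K : Submodule R N, τ.torsion ↥K → K = ⊥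

variable (M : Type v) [AddCommGroup M] [Module R M]

/-- `N` is `χ(M)`-torsion: torsion for some (hence for the greatest) hereditary
torsion theory for which `M` is torsion-free. -/
def ChiTorsion (N : Type v) [AddCommGroup N] [Module R N] : Prop :=
  ∃ τ : HTC.{u, v} R, TorsionFreeFor R τ M ∧ τ.torsion N

/-- `N` is `χ(M)`-torsion-free. -/
def ChiTorsionFree (N : Type v) [AddCommGroup N] [Module R N] : Prop :=
  ∀ K : Submodule R N, ChiTorsion R M ↥K → K = ⊥

/-- `X` is `M`-singular: `X ≅ L/K` with `L ∈ σ[M]` and `K` essential in `L`. -/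
def IsMSingular (X : Type v) [AddCommGroup X] [Module R X] : Prop :=
  ∃ (L : Type v) (iL : AddCommGroup L)
    (mL : @Module R L inferInstance iL.toAddCommMonoid),
    letI := iL
    letI := mL
    InSigma R M L ∧ ∃ K : Submodule R L,
      (∀ K' : Submodule R L, K' ≠ ⊥ → K ⊓ K' ≠ ⊥) ∧ Nonempty (X ≃ₗ[R] (L ⧸ K))

/-- The `M`-singular submodule `Z(M)` of `M`. -/
def singularSub : Submodule R M :=
  sSup {K : Submodule R M | IsMSingular R M ↥K}

/-- `Ass_M(X)`: the set of primes in `M` associated to `X`. -/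
def AssM (X : Type v) [AddCommGroup X] [Module R X] : Set (Submodule R M) :=
  {P | P ≠ ⊤ ∧ IsFullyInvariant R M P ∧
    ∃ L : Submodule R X, L ≠ ⊥ ∧
      ∀ L' : Submodule R X, L' ≠ ⊥ → L' ≤ L → annM R M ↥L' = P}

/-- `E` is an injective object of `σ[M]`. -/
def InjInSigma (E : Type v) [AddCommGroup E] [Module R E] : Prop :=
  InSigma R M E ∧
    ∀ (B : Type v) [AddCommGroup B] [Module R B], InSigma R M B →
      ∀ (A : Submodule R B) (f : ↥A →ₗ[R] E),
        ∃ g : B →ₗ[R] E, ∀ a : A, g ↑a = f a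

/-- `E` is an indecomposable module. -/
def Indecomp (E : Type v) [AddCommGroup E] [Module R E] : Prop :=
  (⊥ : Submodule R E) ≠ ⊤ ∧
    ∀ A B : Submodule R E, IsCompl A B → A = ⊥ ∨ A = ⊤

/-- `M` has finite uniform dimension: there is no infinite independent family
of nonzero submodules. -/
def FiniteUniformDimension : Prop :=
  ¬ ∃ f : ℕ → Submodule R M, (∀ n, f n ≠ ⊥) ∧
      ∀ n : ℕ, f n ⊓ (⨆ m ∈ {m : ℕ | m ≠ n}, f m) = ⊥

/-- `M` is a continuous module (conditions C1 and C2). -/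
def ContinuousModule : Prop :=
  (∀ N : Submodule R M, ∃ D : Submodule R M, (∃ D', IsCompl D D') ∧ N ≤ D ∧
      ∀ L : Submodule R M, L ≤ D → L ≠ ⊥ → N ⊓ L ≠ ⊥) ∧
  (∀ N D : Submodule R M, (∃ D', IsCompl D D') → Nonempty (↥N ≃ₗ[R] ↥D) →
      ∃ N', IsCompl N N')

end Torsion

section FullyInvariant

variable {R : Type u} [Ring R] {M : Type v} [AddCommGroup M] [Module R M]

theorem map_le_prodM {K L : Submodule R M} {f : M →ₗ[R] M} (hf : LinearMap.range f ≤ L) :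
    Submodule.map f K ≤ prodM R M K L :=
  le_iSup₂_of_le f hf le_rfl

theorem prodM_le_iff {K L N : Submodule R M} :
    prodM R M K L ≤ N ↔ ∀ f : M →ₗ[R] M, LinearMap.range f ≤ L → Submodule.map f K ≤ N :=
  iSup₂_le_iff

theorem prodM_mono {K K' L L' : Submodule R M} (hK : K ≤ K') (hL : L ≤ L') :
    prodM R M K L ≤ prodM R M K' L' :=
  prodM_le_iff.2 fun _ hf => (Submodule.map_mono hK).trans (map_le_prodM (hf.trans hL))

theorem prodM_le_right (K L : Submodule R M) : prodM R M K L ≤ L :=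
  prodM_le_iff.2 fun _ hf => LinearMap.map_le_range.trans hf

theorem prodM_le_left {K : Submodule R M} (hK : IsFullyInvariant R M K) (L : Submodule R M) :
    prodM R M K L ≤ K :=
  prodM_le_iff.2 fun f _ => hK f

/-- The smallest fully invariant submodule containing `L`. -/
def fullyInvariantHull (L : Submodule R M) : Submodule R M :=
  ⨆ h : M →ₗ[R] M, Submodule.map h L

theorem le_fullyInvariantHull (L : Submodule R M) : L ≤ fullyInvariantHull L :=
  le_iSup_of_le LinearMap.id (by rw [Submodule.map_id])

theorem fullyInvariantHull_le {K L : Submodule R M} (hK : IsFullyInvariant R M K)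
    (h : L ≤ K) : fullyInvariantHull L ≤ K :=
  iSup_le fun f => (Submodule.map_mono h).trans (hK f)

theorem isFullyInvariant_fullyInvariantHull (L : Submodule R M) :
    IsFullyInvariant R M (fullyInvariantHull L) := by
  intro f
  rw [fullyInvariantHull, Submodule.map_iSup]
  refine iSup_le fun h => ?_
  rw [← Submodule.map_comp]
  exact le_iSup (fun h : M →ₗ[R] M => Submodule.map h L) (f ∘ₗ h)

theorem IsFullyInvariant.sSup {C : Set (Submodule R M)}
    (hC : ∀ N ∈ C, IsFullyInvariant R M N) : IsFullyInvariant R M (sSup C) := by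
  intro f
  rw [Submodule.map_le_iff_le_comap]
  exact sSup_le fun N hN => Submodule.map_le_iff_le_comap.1 ((hC N hN f).trans (le_sSup hN))

theorem IsFullyInvariant.sInf {C : Set (Submodule R M)}
    (hC : ∀ N ∈ C, IsFullyInvariant R M N) : IsFullyInvariant R M (sInf C) :=
  fun f => le_sInf fun N hN => (Submodule.map_mono (sInf_le hN)).trans (hC N hN f)

theorem IsFullyInvariant.sup {K L : Submodule R M} (hK : IsFullyInvariant R M K)
    (hL : IsFullyInvariant R M L) : IsFullyInvariant R M (K ⊔ L) := by
  intro f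
  rw [Submodule.map_sup]
  exact sup_le_sup (hK f) (hL f)

theorem inSigma_finsupp_submodule {ι : Type v} (A : Submodule R (ι →₀ M)) :
    InSigma R M A :=
  ⟨ι, ⊥, (Submodule.quotEquivOfEqBot ⊥ rfl).symm.toLinearMap ∘ₗ A.subtype,
    (Submodule.quotEquivOfEqBot (⊥ : Submodule R (ι →₀ M)) rfl).symm.injective.comp
      A.injective_subtype⟩

theorem inSigma_submodule (B : Submodule R M) : InSigma R M B :=
  ⟨PUnit, ⊥, (Submodule.quotEquivOfEqBot ⊥ rfl).symm.toLinearMap ∘ₗ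
      Finsupp.lsingle PUnit.unit ∘ₗ B.subtype,
    (Submodule.quotEquivOfEqBot (⊥ : Submodule R (PUnit →₀ M)) rfl).symm.injective.comp
      ((Finsupp.single_injective PUnit.unit).comp B.injective_subtype)⟩

theorem prodM_iSup_map_le (hproj : ProjInSigma R M) {ι : Type v} (h : ι → M →ₗ[R] M)
    (L : ι → Submodule R M) (N : Submodule R M) :
    prodM R M N (⨆ i, Submodule.map (h i) (L i)) ≤
      ⨆ i, Submodule.map (h i) (prodM R M N (L i)) := by
  classical
  set B := ⨆ i, Submodule.map (h i) (L i)
  let A : Submodule R (ι →₀ M) := ⨅ i, (L i).comap (Finsupp.lapply i)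
  have mem_A (a : A) (i : ι) : (a : ι →₀ M) i ∈ L i := (Submodule.mem_iInf _).1 a.2 i
  let q : (ι →₀ M) →ₗ[R] M := Finsupp.lsum ℕ h
  have q_apply (a : ι →₀ M) : q a = ∑ i ∈ a.support, h i (a i) := rfl
  have hq : ∀ a : A, (q ∘ₗ A.subtype) a ∈ B := fun a => by
    change q a ∈ B
    rw [q_apply]
    exact Submodule.sum_mem _ fun i _ =>
      Submodule.mem_iSup_of_mem i (Submodule.mem_map_of_mem (mem_A a i))
  let p : A →ₗ[R] B := (q ∘ₗ A.subtype).codRestrict B hq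
  have hp : Function.Surjective p := by
    have hle : B ≤ A.map q := iSup_le fun i => by
      rintro _ ⟨x, hx, rfl⟩
      refine ⟨Finsupp.single i x, (Submodule.mem_iInf _).2 fun j => ?_, by simp [q]⟩
      by_cases hij : i = j
      · subst hij
        simpa using hx
      · simp [hij]
    rintro ⟨b, hb⟩
    obtain ⟨a, ha, rfl⟩ := hle hb
    exact ⟨⟨a, ha⟩, rfl⟩
  refine prodM_le_iff.2 fun f hf => ?_
  obtain ⟨g, hg⟩ := hproj A B (inSigma_finsupp_submodule A) (inSigma_submodule B) p hp
    (f.codRestrict B fun x => hf ⟨x, rfl⟩)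
  rintro _ ⟨x, hx, rfl⟩
  have hfx : f x = q (g x) := (congrArg Subtype.val (LinearMap.congr_fun hg x)).symm
  rw [hfx, q_apply]
  refine Submodule.sum_mem _ fun i _ => Submodule.mem_iSup_of_mem i ?_
  refine Submodule.mem_map_of_mem ?_
  refine map_le_prodM (f := Finsupp.lapply i ∘ₗ A.subtype ∘ₗ g) ?_ ⟨x, hx, rfl⟩
  rintro _ ⟨y, rfl⟩
  exact mem_A (g y) i

theorem prodM_fullyInvariantHull_eq_bot (hproj : ProjInSigma R M) {N L : Submodule R M}
    (h : prodM R M N L = ⊥) : prodM R M N (fullyInvariantHull L) = ⊥ := by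
  refine le_bot_iff.1 ((prodM_iSup_map_le hproj _ (fun _ => L) N).trans ?_)
  simp [h]

theorem prodM_sup_le (hproj : ProjInSigma R M) (N K L : Submodule R M) :
    prodM R M N (K ⊔ L) ≤ prodM R M N K ⊔ prodM R M N L := by
  have := prodM_iSup_map_le hproj (fun _ : ULift.{v} Bool => LinearMap.id)
    (fun b => cond b.down K L) N
  simpa only [Submodule.map_id, iSup_ulift, iSup_bool_eq, cond_true, cond_false] using this

theorem prodM_sup_sup_le (hproj : ProjInSigma R M) {K L P : Submodule R M}
    (hP : IsFullyInvariant R M P) (h : prodM R M K L ≤ P) :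
    prodM R M (K ⊔ P) (L ⊔ P) ≤ P := by
  refine (prodM_sup_le hproj _ _ _).trans (sup_le ?_ (prodM_le_right _ _))
  refine prodM_le_iff.2 fun f hf => ?_
  rw [Submodule.map_sup]
  exact sup_le ((map_le_prodM hf).trans h) (hP f)

theorem exists_primeIn_notMem (hproj : ProjInSigma R M) (hsemi : IsSemiprime R M)
    {x : M} (hx : x ≠ 0) : ∃ P : Submodule R M, PrimeIn R M P ∧ x ∉ P := by
  let H : M → Submodule R M := fun y => fullyInvariantHull (Submodule.span R {y})
  have mem_H (y : M) : y ∈ H y := le_fullyInvariantHull _ (Submodule.mem_span_singleton_self y)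
  have H_le {y : M} {K : Submodule R M} (hK : IsFullyInvariant R M K) (hy : y ∈ K) : H y ≤ K :=
    fullyInvariantHull_le hK ((Submodule.span_singleton_le_iff_mem y K).2 hy)
  have step : ∀ y : {y : M // y ≠ 0}, ∃ z : {z : M // z ≠ 0},
      (z : M) ∈ prodM R M (H y) (H y) := by
    rintro ⟨y, hy⟩
    have hne : prodM R M (H y) (H y) ≠ ⊥ := fun h0 => hy (by
      have hm := mem_H y
      rwa [hsemi _ h0, Submodule.mem_bot] at hm)
    obtain ⟨z, hz, hz0⟩ := Submodule.exists_mem_ne_zero_of_ne_bot hne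
    exact ⟨⟨z, hz0⟩, hz⟩
  choose F hF using step
  let s : ℕ → {y : M // y ≠ 0} := fun n => F^[n] ⟨x, hx⟩
  have hs (n : ℕ) : (s (n + 1) : M) ∈ prodM R M (H (s n)) (H (s n)) := by
    simp only [s, Function.iterate_succ_apply']
    exact hF _
  have anti : Antitone fun n => H (s n) := antitone_nat_of_succ_le fun n =>
    H_le (isFullyInvariant_fullyInvariantHull _) (prodM_le_right _ _ (hs n))
  obtain ⟨P, -, hPmax⟩ := zorn_le_nonempty₀
    {Q : Submodule R M | IsFullyInvariant R M Q ∧ ∀ n, (s n : M) ∉ Q}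
    (fun C hC hchain Q hQ => ⟨sSup C, ⟨IsFullyInvariant.sSup fun N hN => (hC hN).1,
      fun n hn => by
        obtain ⟨N, hN, hmem⟩ :=
          (Submodule.mem_sSup_of_directed ⟨Q, hQ⟩ hchain.directedOn).1 hn
        exact (hC hN).2 n hmem⟩, fun N hN => le_sSup hN⟩)
    ⊥ ⟨fun f => by simp, fun n hn => (s n).2 (by simpa using hn)⟩
  obtain ⟨hPinv, hPs⟩ := hPmax.prop
  have key {K : Submodule R M} (hK : IsFullyInvariant R M K) (hKP : ¬ K ≤ P) :
      ∃ n, H (s n) ≤ K ⊔ P := by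
    by_contra! hcon
    refine hKP (le_sup_left.trans (hPmax.le_of_ge ⟨hK.sup hPinv, fun n hn => ?_⟩ le_sup_right))
    exact hcon n (H_le (hK.sup hPinv) hn)
  refine ⟨P, ⟨fun h => hPs 0 (h ▸ Submodule.mem_top), hPinv, fun K L hK hL hKL => ?_⟩, hPs 0⟩
  by_contra! hcon
  obtain ⟨i, hi⟩ := key hK hcon.1
  obtain ⟨j, hj⟩ := key hL hcon.2
  refine hPs (max i j + 1) (prodM_sup_sup_le hproj hPinv hKL (prodM_mono ?_ ?_ (hs _)))
  · exact (anti (le_max_left i j)).trans hi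
  · exact (anti (le_max_right i j)).trans hj

theorem PrimeIn.sInf {C : Set (Submodule R M)} (hC : ∀ P ∈ C, PrimeIn R M P)
    (hchain : IsChain (· ≤ ·) C) (hne : C.Nonempty) : PrimeIn R M (sInf C) := by
  obtain ⟨P₀, hP₀⟩ := hne
  refine ⟨fun h => (hC P₀ hP₀).1 (top_le_iff.1 (h ▸ sInf_le hP₀)),
    IsFullyInvariant.sInf fun P hP => (hC P hP).2.1, fun K L hK hL hKL => ?_⟩
  by_contra! hcon
  obtain ⟨P, hP, hKP⟩ : ∃ P ∈ C, ¬ K ≤ P := by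
    by_contra! h
    exact hcon.1 (le_sInf h)
  obtain ⟨Q, hQ, hLQ⟩ : ∃ Q ∈ C, ¬ L ≤ Q := by
    by_contra! h
    exact hcon.2 (le_sInf h)
  have hP' := ((hC P hP).2.2 K L hK hL (hKL.trans (sInf_le hP))).resolve_left hKP
  have hQ' := ((hC Q hQ).2.2 K L hK hL (hKL.trans (sInf_le hQ))).resolve_right hLQ
  rcases hchain.total hP hQ with h | h
  · exact hLQ (hP'.trans h)
  · exact hKP (hQ'.trans h)

theorem exists_minPrimeIn_le {P : Submodule R M} (hP : PrimeIn R M P) :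
    ∃ Q, MinPrimeIn R M Q ∧ Q ≤ P := by
  obtain ⟨Q, hQP, hQ⟩ := zorn_le_nonempty₀ (α := (Submodule R M)ᵒᵈ)
    {Q | PrimeIn R M (OrderDual.ofDual Q)}
    (fun C hC hchain Q hQ => ⟨OrderDual.toDual (sInf (OrderDual.toDual ⁻¹' C)),
      PrimeIn.sInf (fun N hN => hC hN)
        (fun a ha b hb hab => (hchain ha hb hab).symm) ⟨_, hQ⟩,
      fun N hN => sInf_le (α := Submodule R M) hN⟩)
    (OrderDual.toDual P) hP
  exact ⟨OrderDual.ofDual Q, ⟨hQ.prop, fun Q' hQ' hle => le_antisymm hle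
    (hQ.le_of_ge (y := OrderDual.toDual Q') hQ' hle)⟩, hQP⟩

theorem sInf_minPrimeIn_eq_bot (hproj : ProjInSigma R M) (hsemi : IsSemiprime R M) :
    sInf {P : Submodule R M | MinPrimeIn R M P} = ⊥ := by
  refine (Submodule.eq_bot_iff _).2 fun x hx => ?_
  by_contra hx0
  obtain ⟨P, hP, hxP⟩ := exists_primeIn_notMem hproj hsemi hx0
  obtain ⟨Q, hQ, hQP⟩ := exists_minPrimeIn_le hP
  exact hxP (hQP ((Submodule.mem_sInf).1 hx Q hQ))

end FullyInvariant

/-- Lemma 2.25: `Ann_M^r(P_i) = ∩_{j ≠ i} P_j` for each `i`. -/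
theorem stmt_17 (R : Type u) [Ring R] (M : Type v) [AddCommGroup M] [Module R M]
    (hproj : ProjInSigma R M) (hsemi : IsSemiprime R M)
    (hacc : AccOnAnnihilators R M)
    (n : ℕ) (hn : 2 ≤ n) (P : Fin n → Submodule R M)
    (hinj : Function.Injective P)
    (hmin : ∀ i, MinPrimeIn R M (P i))
    (hall : ∀ Q : Submodule R M, MinPrimeIn R M Q → ∃ i, Q = P i) :
    ∀ i : Fin n, annMr R M (P i) = ⨅ j ∈ {j : Fin n | j ≠ i}, P j := by
  intro i
  apply le_antisymm
  · refine sSup_le fun L hL => le_iInf₂ fun j hj => (le_fullyInvariantHull L).trans ?_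
    have h0 := prodM_fullyInvariantHull_eq_bot hproj hL
    refine ((hmin j).1.2.2 _ _ (hmin i).1.2.1 (isFullyInvariant_fullyInvariantHull L)
      (h0.trans_le bot_le)).resolve_left fun hle => hj ?_
    exact (hinj ((hmin j).2 _ (hmin i).1 hle)).symm
  · refine le_sSup (le_bot_iff.1 ?_)
    rw [← sInf_minPrimeIn_eq_bot hproj hsemi]
    refine le_sInf fun Q hQ => ?_
    obtain ⟨j, rfl⟩ := hall Q hQ
    by_cases hj : j = i
    · subst hj
      exact prodM_le_left (hmin j).1.2.1 _
    · exact (prodM_le_right _ _).trans (iInf₂_le j hj)
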